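/- (Sobolev product law, Fourier-side form, first part.) Let s₁, s₂ ∈ ℝ with s₁ + s₂ > 0 and s₁ < 3/2. There exists a constant C = C(s₁, s₂) > 0 such that for all measurable functions F, G : ℝ³ → ℂ for which the four quantities ∫_{ℝ³} |ξ|^{2s₁}|F(ξ)|² dξ, ∫_{ℝ³} |ξ|^{2s₂}|F(ξ)|² dξ, ∫_{ℝ³} |ξ|^{2s₁}|G(ξ)|² dξ, ∫_{ℝ³} |ξ|^{2s₂}|G(ξ)|² dξ are finite, the convolution (F∗G)(ξ) = ∫_{ℝ³} F(η)·G(ξ − η) dη is well defined for almost every ξ and satisfies (∫_{ℝ³} |ξ|^{2(s₁+s₂−3/2)} |(F∗G)(ξ)|² dξ)^{1/2} ≤ C·[ (∫ |ξ|^{2s₁}|F(ξ)|² dξ)^{1/2}·(∫ |ξ|^{2s₂}|G(ξ)|² dξ)^{1/2} + (∫ |ξ|^{2s₂}|F(ξ)|² dξ)^{1/2}·(∫ |ξ|^{2s₁}|G(ξ)|² dξ)^{1/2} ]. -/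

import Mathlib

open MeasureTheory

/-- The homogeneous weight `‖x‖ ^ s`, as an extended nonnegative real. -/
noncomputable def normWeight {E : Type*} [NormedAddCommGroup E] (s : ℝ) (x : E) : ENNReal :=
  ENNReal.ofReal (‖x‖ ^ s)

section Weight

variable {E : Type*} [NormedAddCommGroup E]

lemma measurable_normWeight [MeasurableSpace E] [OpensMeasurableSpace E] (s : ℝ) :
    Measurable (normWeight s : E → ENNReal) :=
  (measurable_norm.pow_const s).ennreal_ofReal

lemma normWeight_ne_top (s : ℝ) (x : E) : normWeight s x ≠ ⊤ := ENNReal.ofReal_ne_top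

lemma normWeight_ne_zero (s : ℝ) {x : E} (hx : x ≠ 0) : normWeight s x ≠ 0 := by
  have := norm_pos_iff.2 hx
  simp only [normWeight, ne_eq, ENNReal.ofReal_eq_zero, not_le]
  positivity

lemma normWeight_add (s t : ℝ) {x : E} (hx : x ≠ 0) :
    normWeight (s + t) x = normWeight s x * normWeight t x := by
  rw [normWeight, normWeight, normWeight, ← ENNReal.ofReal_mul (by positivity),
    Real.rpow_add (norm_pos_iff.2 hx)]

lemma normWeight_zero (x : E) : normWeight 0 x = 1 := by simp [normWeight]

lemma normWeight_sq (s : ℝ) (x : E) : normWeight s x ^ 2 = normWeight (2 * s) x := by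
  rw [normWeight, normWeight, ← ENNReal.ofReal_pow (by positivity), ← Real.rpow_mul_natCast
    (norm_nonneg x)]
  norm_num [mul_comm]

lemma normWeight_neg_mul_self (s : ℝ) {x : E} (hx : x ≠ 0) :
    normWeight (-s) x * normWeight s x = 1 := by
  rw [← normWeight_add _ _ hx, neg_add_cancel, normWeight_zero]

lemma normWeight_le_of_comparable (s : ℝ) {x y : E} (hx : x ≠ 0) (h₁ : ‖x‖ ≤ 2 * ‖y‖)
    (h₂ : ‖y‖ ≤ 2 * ‖x‖) :
    normWeight s x ≤ ENNReal.ofReal (2 ^ |s|) * normWeight s y := by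
  have hx' := norm_pos_iff.2 hx
  have hy' : 0 < ‖y‖ := by linarith
  rw [normWeight, normWeight, ← ENNReal.ofReal_mul (by positivity)]
  apply ENNReal.ofReal_le_ofReal
  rcases le_total 0 s with hs | hs
  · rw [abs_of_nonneg hs, ← Real.mul_rpow (by norm_num) hy'.le]
    exact Real.rpow_le_rpow hx'.le h₁ hs
  · rw [abs_of_nonpos hs, Real.rpow_neg (by norm_num), ← Real.inv_rpow (by norm_num),
      ← Real.mul_rpow (by norm_num) hy'.le]
    exact Real.rpow_le_rpow_of_nonpos (by positivity) (by linarith) hs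

end Weight

lemma sq_lintegral_mul_le {α : Type*} [MeasurableSpace α] (μ : Measure α) {f g : α → ENNReal}
    (hf : AEMeasurable f μ) (hg : AEMeasurable g μ) :
    (∫⁻ a, f a * g a ∂μ) ^ 2 ≤ (∫⁻ a, f a ^ 2 ∂μ) * ∫⁻ a, g a ^ 2 ∂μ := by
  have h := ENNReal.lintegral_mul_le_Lp_mul_Lq μ Real.HolderConjugate.two_two hf hg
  have h2 := pow_le_pow_left' h 2
  simp only [Pi.mul_apply, ENNReal.rpow_ofNat, mul_pow, ← ENNReal.rpow_mul_natCast] at h2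
  simpa using h2

section Convolution

variable {E : Type*} [NormedAddCommGroup E] [NormedSpace ℝ E] [FiniteDimensional ℝ E]
  [MeasurableSpace E] [BorelSpace E] (μ : Measure E) [μ.IsAddHaarMeasure]

open Module (finrank)
open scoped Pointwise

lemma lintegral_lintegral_mul_sub {f g : E → ENNReal} (hf : Measurable f) (hg : Measurable g) :
    ∫⁻ x, ∫⁻ y, f y * g (x - y) ∂μ ∂μ = (∫⁻ x, f x ∂μ) * ∫⁻ x, g x ∂μ := by
  rw [lintegral_lintegral_swap (by fun_prop), ← lintegral_mul_const _ hf]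
  refine lintegral_congr fun y ↦ ?_
  rw [lintegral_const_mul _ (by fun_prop), lintegral_sub_right_eq_self]

lemma measurable_setLIntegral_mul_sub {f g : E → ENNReal} (hf : Measurable f) (hg : Measurable g)
    {T : Set (E × E)} (hT : MeasurableSet T) :
    Measurable fun x ↦ ∫⁻ y in {y | (x, y) ∈ T}, f y * g (x - y) ∂μ := by
  have h : Measurable (T.indicator fun q ↦ f q.2 * g (q.1 - q.2)) :=
    Measurable.indicator (by fun_prop) hT
  convert h.lintegral_prod_right' (ν := μ) using 2 with x
  have hx : MeasurableSet {y | (x, y) ∈ T} := measurable_prodMk_left hT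
  rw [← lintegral_indicator hx]
  rfl

variable [Nontrivial E]

lemma ae_ne_zero_of_isAddHaarMeasure : ∀ᵐ x ∂μ, x ≠ 0 := by
  simp [ae_iff]

lemma exists_setLIntegral_normWeight_le {p : ℝ} (hp : 0 < p + finrank ℝ E) :
    ∃ C : ENNReal, C ≠ ⊤ ∧ ∀ x : E, x ≠ 0 →
      ∫⁻ y in {y | ‖y‖ ≤ ‖x‖}, normWeight p y ∂μ ≤ C * normWeight (p + finrank ℝ E) x := by
  have hint : ∀ r : ℝ, IntegrableOn (fun y : E ↦ ‖y‖ ^ p) {y | ‖y‖ ≤ r} μ := by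
    intro r
    have h : IntegrableOn (fun y : E ↦ ‖y‖ ^ p) (Metric.ball 0 (r + 1)) μ := by
      refine integrableOn_ball_of_norm_le_rpow (C := 1) (α := -p) Module.finrank_pos
        (by linarith) (.of_forall fun y ↦ ?_)
        (measurable_norm.pow_const p).aestronglyMeasurable
      rw [Real.norm_of_nonneg (by positivity), neg_neg, one_mul]
    refine h.mono_set fun y (hy : ‖y‖ ≤ r) ↦ ?_
    rw [mem_ball_zero_iff]
    linarith
  refine ⟨ENNReal.ofReal (∫ y in {y : E | ‖y‖ ≤ 1}, ‖y‖ ^ p ∂μ), ENNReal.ofReal_ne_top,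
    fun x hx ↦ ?_⟩
  have hx' := norm_pos_iff.2 hx
  have hset : ‖x‖ • {y : E | ‖y‖ ≤ 1} = {y | ‖y‖ ≤ ‖x‖} := by
    ext y
    rw [Set.mem_smul_set_iff_inv_smul_mem₀ hx'.ne']
    simp only [Set.mem_ofPred_eq, norm_smul, norm_inv, norm_norm]
    rw [inv_mul_le_iff₀ hx', mul_one]
  have hscale := Measure.setIntegral_comp_smul_of_pos μ (fun y : E ↦ ‖y‖ ^ p) {y : E | ‖y‖ ≤ 1} hx'
  rw [hset, smul_eq_mul, eq_inv_mul_iff_mul_eq₀ (by positivity)] at hscale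
  simp only [normWeight]
  rw [← ofReal_integral_eq_lintegral_ofReal (hint _) (.of_forall fun y ↦ by positivity),
    ← ENNReal.ofReal_mul (by positivity), ← hscale]
  simp only [norm_smul, norm_norm, Real.mul_rpow (norm_nonneg _) (norm_nonneg _)]
  rw [integral_const_mul, Real.rpow_add hx', Real.rpow_natCast]
  apply le_of_eq
  congr 1
  ring

lemma exists_lintegral_lowHigh_le {s₁ : ℝ} (s₂ : ℝ) (hs₁ : 2 * s₁ < finrank ℝ E) :
    ∃ C : ENNReal, C ≠ ⊤ ∧ ∀ f g : E → ENNReal, Measurable f → Measurable g →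
      ∫⁻ x, normWeight (2 * (s₁ + s₂) - finrank ℝ E) x *
        (∫⁻ y in {y | ‖y‖ ≤ ‖x - y‖ ∧ ‖x - y‖ ≤ 2 * ‖x‖}, f y * g (x - y) ∂μ) ^ 2 ∂μ ≤
      C * ((∫⁻ x, normWeight (2 * s₁) x * f x ^ 2 ∂μ) *
        ∫⁻ x, normWeight (2 * s₂) x * g x ^ 2 ∂μ) := by
  obtain ⟨K, hK, hball⟩ := exists_setLIntegral_normWeight_le μ (p := -(2 * s₁)) (by linarith)
  set d : ℝ := ((finrank ℝ E : ℕ) : ℝ)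
  set A := ENNReal.ofReal (2 ^ |-(2 * s₁) + d|)
  set B := ENNReal.ofReal (2 ^ |2 * s₂|)
  refine ⟨K * A * B, by simp [A, B, hK, ENNReal.mul_eq_top], fun f g hf hg ↦ ?_⟩
  have hw := fun s ↦ measurable_normWeight (E := E) s
  rw [← lintegral_lintegral_mul_sub μ (by fun_prop) (by fun_prop),
    ← lintegral_const_mul' _ _ (by simp [A, B, hK, ENNReal.mul_eq_top])]
  refine lintegral_mono_ae ?_
  filter_upwards [ae_ne_zero_of_isAddHaarMeasure μ] with x hx
  set S := {y | ‖y‖ ≤ ‖x - y‖ ∧ ‖x - y‖ ≤ 2 * ‖x‖} with hSdef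
  have hS : MeasurableSet S := by
    rw [hSdef, Set.ofPred_and]
    exact (measurableSet_le (by fun_prop) (by fun_prop)).inter
      (measurableSet_le (by fun_prop) (by fun_prop))
  have hcs : (∫⁻ y in S, f y * g (x - y) ∂μ) ^ 2 ≤
      (∫⁻ y in S, normWeight (-(2 * s₁)) y ∂μ) *
        ∫⁻ y in S, normWeight (2 * s₁) y * (f y * g (x - y)) ^ 2 ∂μ := by
    have h := sq_lintegral_mul_le (μ.restrict S) (f := normWeight (-s₁))
      (g := fun y ↦ normWeight s₁ y * (f y * g (x - y))) (by fun_prop) (by fun_prop)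
    simp only [mul_pow, normWeight_sq, mul_neg] at h ⊢
    refine le_trans (le_of_eq ?_) h
    congr 1
    refine lintegral_congr_ae (ae_restrict_of_ae ?_)
    filter_upwards [ae_ne_zero_of_isAddHaarMeasure μ] with y hy
    rw [← mul_assoc, normWeight_neg_mul_self _ hy, one_mul]
  have hfirst : ∫⁻ y in S, normWeight (-(2 * s₁)) y ∂μ ≤
      K * A * normWeight (-(2 * s₁) + d) x := by
    have h2x : ‖(2 : ℝ) • x‖ = 2 * ‖x‖ := by simp [norm_smul]
    have hx0 := norm_nonneg x
    calc _ ≤ ∫⁻ y in {y | ‖y‖ ≤ ‖(2 : ℝ) • x‖}, normWeight (-(2 * s₁)) y ∂μ :=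
          lintegral_mono_set fun y hy ↦ by
            rw [Set.mem_ofPred_eq, h2x]
            exact hy.1.trans hy.2
      _ ≤ K * normWeight (-(2 * s₁) + d) ((2 : ℝ) • x) := hball _ (by simpa using hx)
      _ ≤ _ := by
          rw [mul_assoc]
          gcongr
          exact normWeight_le_of_comparable _ (by simpa using hx) (by linarith) (by linarith)
  calc _ ≤ normWeight (2 * (s₁ + s₂) - d) x * (K * A * normWeight (-(2 * s₁) + d) x *
        ∫⁻ y in S, normWeight (2 * s₁) y * (f y * g (x - y)) ^ 2 ∂μ) := by
        gcongr
        exact hcs.trans (by gcongr)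
    _ = K * A * ∫⁻ y in S, normWeight (2 * s₂) x *
          (normWeight (2 * s₁) y * (f y * g (x - y)) ^ 2) ∂μ := by
        have hadd := normWeight_add (2 * (s₁ + s₂) - d) (-(2 * s₁) + d) hx
        rw [show (2 * (s₁ + s₂) - d) + (-(2 * s₁) + d) = 2 * s₂ by ring] at hadd
        rw [lintegral_const_mul _ (by fun_prop), hadd]
        generalize normWeight (2 * (s₁ + s₂) - d) x = u, normWeight (-(2 * s₁) + d) x = v
        ring
    _ ≤ K * A * ∫⁻ y in S, B *
          (normWeight (2 * s₁) y * f y ^ 2 * (normWeight (2 * s₂) (x - y) * g (x - y) ^ 2)) ∂μ := by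
        gcongr K * A * ?_
        refine setLIntegral_mono' hS fun y hy ↦ ?_
        have htri : ‖x‖ ≤ ‖x - y‖ + ‖y‖ := by simpa using norm_add_le (x - y) y
        have := normWeight_le_of_comparable (2 * s₂) hx (y := x - y)
          (by linarith [hy.1]) hy.2
        calc _ ≤ B * normWeight (2 * s₂) (x - y) *
              (normWeight (2 * s₁) y * (f y * g (x - y)) ^ 2) := by gcongr
          _ = _ := by ring
    _ ≤ _ := by
        rw [lintegral_const_mul _ (by fun_prop), ← mul_assoc]
        gcongr
        exact Measure.restrict_le_self

lemma exists_lintegral_highHigh_le {s₁ s₂ : ℝ} (hs : 0 < s₁ + s₂) :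
    ∃ C : ENNReal, C ≠ ⊤ ∧ ∀ f g : E → ENNReal, Measurable f → Measurable g →
      ∫⁻ x, normWeight (2 * (s₁ + s₂) - finrank ℝ E) x *
        (∫⁻ y in {y | ‖y‖ ≤ ‖x - y‖ ∧ 2 * ‖x‖ < ‖x - y‖}, f y * g (x - y) ∂μ) ^ 2 ∂μ ≤
      C * ((∫⁻ x, normWeight (2 * s₁) x * f x ^ 2 ∂μ) *
        ∫⁻ x, normWeight (2 * s₂) x * g x ^ 2 ∂μ) := by
  obtain ⟨K, hK, hball⟩ := exists_setLIntegral_normWeight_le μ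
    (p := 2 * (s₁ + s₂) - finrank ℝ E) (by linarith)
  rw [sub_add_cancel] at hball
  set d : ℝ := ((finrank ℝ E : ℕ) : ℝ)
  set B := ENNReal.ofReal (2 ^ |2 * s₂|)
  refine ⟨K * B, by simp [B, hK, ENNReal.mul_eq_top], fun f g hf hg ↦ ?_⟩
  have hw := fun s ↦ measurable_normWeight (E := E) s
  set N := ∫⁻ x, normWeight (2 * s₂) x * g x ^ 2 ∂μ
  have hmeas : MeasurableSet {q : E × E | ‖q.1‖ ≤ ‖q.2‖} :=
    measurableSet_le (by fun_prop) (by fun_prop)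
  have hpoint : ∀ x : E,
      (∫⁻ y in {y | ‖y‖ ≤ ‖x - y‖ ∧ 2 * ‖x‖ < ‖x - y‖}, f y * g (x - y) ∂μ) ^ 2 ≤
        (∫⁻ y in {y | ‖x‖ ≤ ‖y‖}, normWeight (-(2 * s₂)) y * f y ^ 2 ∂μ) * (B * N) := by
    intro x
    set S := {y | ‖y‖ ≤ ‖x - y‖ ∧ 2 * ‖x‖ < ‖x - y‖} with hSdef
    have hS : MeasurableSet S := by
      rw [hSdef, Set.ofPred_and]
      exact (measurableSet_le (by fun_prop) (by fun_prop)).inter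
        (measurableSet_lt (by fun_prop) (by fun_prop))
    have htri : ∀ y, ‖x - y‖ ≤ ‖x‖ + ‖y‖ := norm_sub_le x
    have h := sq_lintegral_mul_le (μ.restrict S) (f := fun y ↦ normWeight (-s₂) y * f y)
      (g := fun y ↦ normWeight s₂ y * g (x - y)) (by fun_prop) (by fun_prop)
    simp only [mul_pow, normWeight_sq, mul_neg] at h
    calc (∫⁻ y in S, f y * g (x - y) ∂μ) ^ 2
        = (∫⁻ y in S, normWeight (-s₂) y * f y * (normWeight s₂ y * g (x - y)) ∂μ) ^ 2 := by
          congr 1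
          refine lintegral_congr_ae (ae_restrict_of_ae ?_)
          filter_upwards [ae_ne_zero_of_isAddHaarMeasure μ] with y hy
          rw [mul_mul_mul_comm, normWeight_neg_mul_self _ hy, one_mul]
      _ ≤ _ := h
      _ ≤ _ := by
          gcongr ?_ * ?_
          · exact lintegral_mono_set fun y hy ↦ by
              have := htri y
              have := hy.2
              simp only [Set.mem_ofPred_eq]
              linarith
          · calc _ ≤ ∫⁻ y in S, B * (normWeight (2 * s₂) (x - y) * g (x - y) ^ 2) ∂μ := by
                  refine lintegral_mono_ae ?_
                  filter_upwards [ae_restrict_mem hS,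
                    ae_restrict_of_ae (ae_ne_zero_of_isAddHaarMeasure μ)] with y hy hy0
                  rw [← mul_assoc]
                  gcongr
                  have := htri y
                  exact normWeight_le_of_comparable _ hy0
                    (by linarith [hy.1, norm_nonneg (x - y)]) (by linarith [hy.2])
              _ ≤ ∫⁻ y, B * (normWeight (2 * s₂) (x - y) * g (x - y) ^ 2) ∂μ :=
                  setLIntegral_le_lintegral _ _
              _ = B * N := by
                  rw [lintegral_const_mul _ (by fun_prop),
                    lintegral_sub_left_eq_self (fun z ↦ normWeight (2 * s₂) z * g z ^ 2) x]
  calc _ ≤ ∫⁻ x, normWeight (2 * (s₁ + s₂) - d) x *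
        ((∫⁻ y in {y | ‖x‖ ≤ ‖y‖}, normWeight (-(2 * s₂)) y * f y ^ 2 ∂μ) * (B * N)) ∂μ := by
        gcongr with x
        exact hpoint x
    _ = (∫⁻ x, ∫⁻ y, {q : E × E | ‖q.1‖ ≤ ‖q.2‖}.indicator
          (fun q ↦ normWeight (2 * (s₁ + s₂) - d) q.1 * (normWeight (-(2 * s₂)) q.2 * f q.2 ^ 2))
          (x, y) ∂μ ∂μ) * (B * N) := by
        rw [← lintegral_mul_const _ (by
          apply Measurable.lintegral_prod_right'
          exact Measurable.indicator (by fun_prop) hmeas)]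
        refine lintegral_congr fun x ↦ ?_
        rw [← mul_assoc, ← lintegral_const_mul _ (by fun_prop),
          ← lintegral_indicator (measurableSet_le (by fun_prop) (by fun_prop))]
        rfl
    _ = (∫⁻ y, normWeight (-(2 * s₂)) y * f y ^ 2 *
          ∫⁻ x in {x | ‖x‖ ≤ ‖y‖}, normWeight (2 * (s₁ + s₂) - d) x ∂μ ∂μ) * (B * N) := by
        have hind : Measurable ({q : E × E | ‖q.1‖ ≤ ‖q.2‖}.indicator fun q ↦
            normWeight (2 * (s₁ + s₂) - d) q.1 * (normWeight (-(2 * s₂)) q.2 * f q.2 ^ 2)) :=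
          Measurable.indicator (by fun_prop) hmeas
        rw [lintegral_lintegral_swap (by exact hind.aemeasurable)]
        congr 1
        refine lintegral_congr fun y ↦ ?_
        rw [← lintegral_const_mul _ (by fun_prop),
          ← lintegral_indicator (measurableSet_le (by fun_prop) (by fun_prop))]
        refine lintegral_congr fun x ↦ ?_
        simp only [Set.indicator, Set.mem_ofPred_eq, mul_comm]
    _ ≤ (∫⁻ y, K * (normWeight (2 * s₁) y * f y ^ 2) ∂μ) * (B * N) := by
        gcongr ?_ * _
        refine lintegral_mono_ae ?_
        filter_upwards [ae_ne_zero_of_isAddHaarMeasure μ] with y hy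
        calc _ ≤ normWeight (-(2 * s₂)) y * f y ^ 2 * (K * normWeight (2 * (s₁ + s₂)) y) := by
              gcongr
              exact hball y hy
          _ = _ := by
              rw [show 2 * s₁ = -(2 * s₂) + 2 * (s₁ + s₂) by ring, normWeight_add _ _ hy]
              ring
    _ = _ := by
        rw [lintegral_const_mul _ (by fun_prop)]
        ring

lemma exists_lintegral_normWeight_mul_sq_convolution_le {s₁ s₂ : ℝ} (hs : 0 < s₁ + s₂)
    (hs₁ : 2 * s₁ < finrank ℝ E) :
    ∃ C : ENNReal, C ≠ ⊤ ∧ ∀ f g : E → ENNReal, Measurable f → Measurable g →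
      ∫⁻ x, normWeight (2 * (s₁ + s₂) - finrank ℝ E) x * (∫⁻ y, f y * g (x - y) ∂μ) ^ 2 ∂μ ≤
      C * ((∫⁻ x, normWeight (2 * s₁) x * f x ^ 2 ∂μ) *
          (∫⁻ x, normWeight (2 * s₂) x * g x ^ 2 ∂μ) +
        (∫⁻ x, normWeight (2 * s₂) x * f x ^ 2 ∂μ) *
          ∫⁻ x, normWeight (2 * s₁) x * g x ^ 2 ∂μ) := by
  obtain ⟨C₁, hC₁, hlow⟩ := exists_lintegral_lowHigh_le μ s₂ hs₁
  obtain ⟨C₂, hC₂, hhigh⟩ := exists_lintegral_highHigh_le μ hs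
  set d : ℝ := ((finrank ℝ E : ℕ) : ℝ)
  have hw := fun s ↦ measurable_normWeight (E := E) s
  let w : E → ENNReal := normWeight (2 * (s₁ + s₂) - d)
  let L (f g : E → ENNReal) (x : E) : ENNReal :=
    ∫⁻ y in {y | ‖y‖ ≤ ‖x - y‖ ∧ ‖x - y‖ ≤ 2 * ‖x‖}, f y * g (x - y) ∂μ
  let H (f g : E → ENNReal) (x : E) : ENNReal :=
    ∫⁻ y in {y | ‖y‖ ≤ ‖x - y‖ ∧ 2 * ‖x‖ < ‖x - y‖}, f y * g (x - y) ∂μ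
  have hL {f g : E → ENNReal} (hf : Measurable f) (hg : Measurable g) : Measurable (L f g) :=
    measurable_setLIntegral_mul_sub μ hf hg (T := {q | ‖q.2‖ ≤ ‖q.1 - q.2‖ ∧
        ‖q.1 - q.2‖ ≤ 2 * ‖q.1‖})
      (by
        rw [Set.ofPred_and]
        exact (measurableSet_le (by fun_prop) (by fun_prop)).inter
          (measurableSet_le (by fun_prop) (by fun_prop)))
  have hH {f g : E → ENNReal} (hf : Measurable f) (hg : Measurable g) : Measurable (H f g) :=
    measurable_setLIntegral_mul_sub μ hf hg (T := {q | ‖q.2‖ ≤ ‖q.1 - q.2‖ ∧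
        2 * ‖q.1‖ < ‖q.1 - q.2‖})
      (by
        rw [Set.ofPred_and]
        exact (measurableSet_le (by fun_prop) (by fun_prop)).inter
          (measurableSet_lt (by fun_prop) (by fun_prop)))
  have hhalf (f g : E → ENNReal) (x : E) :
      ∫⁻ y in {y | ‖y‖ ≤ ‖x - y‖}, f y * g (x - y) ∂μ ≤ L f g x + H f g x := by
    refine (lintegral_mono_set fun y (hy : ‖y‖ ≤ ‖x - y‖) ↦ ?_).trans (lintegral_union_le _ _ _)
    rcases le_or_gt ‖x - y‖ (2 * ‖x‖) with h | h
    · exact Or.inl ⟨hy, h⟩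
    · exact Or.inr ⟨hy, h⟩
  have hreflect {f g : E → ENNReal} (x : E) :
      ∫⁻ y in {y | ‖x - y‖ ≤ ‖y‖}, f y * g (x - y) ∂μ =
        ∫⁻ y in {y | ‖y‖ ≤ ‖x - y‖}, g y * f (x - y) ∂μ := by
    rw [← lintegral_indicator (measurableSet_le (by fun_prop) (by fun_prop)),
      ← lintegral_indicator (measurableSet_le (by fun_prop) (by fun_prop)),
      ← lintegral_sub_left_eq_self _ x]
    refine lintegral_congr fun y ↦ ?_
    simp [Set.indicator, mul_comm]
  have hsplit (f g : E → ENNReal) (x : E) :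
      ∫⁻ y, f y * g (x - y) ∂μ ≤ (L f g x + H f g x) + (L g f x + H g f x) := by
    calc _ = ∫⁻ y in Set.univ, f y * g (x - y) ∂μ := by simp
      _ ≤ _ := lintegral_mono_set fun y _ ↦ le_total ‖y‖ ‖x - y‖
      _ ≤ _ := lintegral_union_le _ {y | ‖y‖ ≤ ‖x - y‖} {y | ‖x - y‖ ≤ ‖y‖}
      _ ≤ _ := by
          rw [hreflect]
          gcongr <;> exact hhalf _ _ _
  have hsq (a b c e : ENNReal) :
      ((a + b) + (c + e)) ^ 2 ≤ 4 * (a ^ 2 + b ^ 2 + (c ^ 2 + e ^ 2)) := by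
    have h2 (a b : ENNReal) : (a + b) ^ 2 ≤ 2 * (a ^ 2 + b ^ 2) := by
      have := ENNReal.rpow_add_le_mul_rpow_add_rpow a b (p := 2) (by norm_num)
      norm_num at this
      exact this
    calc _ ≤ 2 * ((a + b) ^ 2 + (c + e) ^ 2) := h2 _ _
      _ ≤ 2 * (2 * (a ^ 2 + b ^ 2) + 2 * (c ^ 2 + e ^ 2)) := by gcongr <;> exact h2 _ _
      _ = _ := by ring
  refine ⟨4 * (C₁ + C₂), by simp [hC₁, hC₂, ENNReal.mul_eq_top], fun f g hf hg ↦ ?_⟩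
  have hLfg := hL hf hg
  have hLgf := hL hg hf
  have hHfg := hH hf hg
  have hHgf := hH hg hf
  calc _ ≤ ∫⁻ x, 4 * (w x * L f g x ^ 2 + w x * H f g x ^ 2 +
        (w x * L g f x ^ 2 + w x * H g f x ^ 2)) ∂μ := by
        refine lintegral_mono fun x ↦ ?_
        calc _ ≤ w x * (4 * (L f g x ^ 2 + H f g x ^ 2 + (L g f x ^ 2 + H g f x ^ 2))) := by
              gcongr
              exact (pow_le_pow_left' (hsplit f g x) 2).trans (hsq _ _ _ _)
          _ = _ := by ring
    _ = 4 * ((∫⁻ x, w x * L f g x ^ 2 ∂μ) + (∫⁻ x, w x * H f g x ^ 2 ∂μ) +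
        ((∫⁻ x, w x * L g f x ^ 2 ∂μ) + ∫⁻ x, w x * H g f x ^ 2 ∂μ)) := by
        rw [lintegral_const_mul _ (by fun_prop), lintegral_add_left (by fun_prop),
          lintegral_add_left (by fun_prop), lintegral_add_left (by fun_prop)]
    _ ≤ _ := by
        grw [hlow f g hf hg, hhigh f g hf hg, hlow g f hg hf, hhigh g f hg hf]
        apply le_of_eq
        ring

end Convolution

lemma lintegral_normWeight_mul_sq_enorm {E F : Type*} [NormedAddCommGroup E]
    [MeasurableSpace E] [NormedAddCommGroup F] {μ : Measure E} {s : ℝ} {f : E → F}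
    (hf : Integrable (fun x ↦ ‖x‖ ^ s * ‖f x‖ ^ 2) μ) :
    ∫⁻ x, normWeight s x * ‖f x‖ₑ ^ 2 ∂μ = ENNReal.ofReal (∫ x, ‖x‖ ^ s * ‖f x‖ ^ 2 ∂μ) := by
  rw [ofReal_integral_eq_lintegral_ofReal hf (.of_forall fun x ↦ by positivity)]
  refine lintegral_congr fun x ↦ ?_
  rw [normWeight, ENNReal.ofReal_mul (by positivity), ENNReal.ofReal_pow (norm_nonneg _),
    ofReal_norm]

/-- Sobolev product law (Fourier-side form, first part): for `s₁ + s₂ > 0`, `s₁ < 3/2`,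
there is `C > 0` so that for measurable `F, G : ℝ³ → ℂ` with the four weighted `L²` quantities
finite, the convolution `F ∗ G` is a.e. well defined and
`‖F∗G‖_{Ḣ^{s₁+s₂−3/2}} ≤ C (‖F‖_{Ḣ^{s₁}}‖G‖_{Ḣ^{s₂}} + ‖F‖_{Ḣ^{s₂}}‖G‖_{Ḣ^{s₁}})`
(all norms written as weighted integrals on the Fourier side). -/
theorem stmt_3 (s₁ s₂ : ℝ) (hs : 0 < s₁ + s₂) (hs₁ : s₁ < 3 / 2) :
    ∃ C > (0 : ℝ), ∀ F G : EuclideanSpace ℝ (Fin 3) → ℂ,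
      Measurable F → Measurable G →
      Integrable (fun ξ => ‖ξ‖ ^ (2 * s₁) * ‖F ξ‖ ^ 2) →
      Integrable (fun ξ => ‖ξ‖ ^ (2 * s₂) * ‖F ξ‖ ^ 2) →
      Integrable (fun ξ => ‖ξ‖ ^ (2 * s₁) * ‖G ξ‖ ^ 2) →
      Integrable (fun ξ => ‖ξ‖ ^ (2 * s₂) * ‖G ξ‖ ^ 2) →
      (∀ᵐ ξ, Integrable (fun η => F η * G (ξ - η))) ∧
      (∫⁻ ξ, ENNReal.ofReal
            (‖ξ‖ ^ (2 * (s₁ + s₂ - 3 / 2)) * ‖∫ η, F η * G (ξ - η)‖ ^ 2)) ^ (1 / 2 : ℝ) ≤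
        ENNReal.ofReal (C *
          ((∫ ξ, ‖ξ‖ ^ (2 * s₁) * ‖F ξ‖ ^ 2) ^ (1 / 2 : ℝ) *
              (∫ ξ, ‖ξ‖ ^ (2 * s₂) * ‖G ξ‖ ^ 2) ^ (1 / 2 : ℝ) +
            (∫ ξ, ‖ξ‖ ^ (2 * s₂) * ‖F ξ‖ ^ 2) ^ (1 / 2 : ℝ) *
              (∫ ξ, ‖ξ‖ ^ (2 * s₁) * ‖G ξ‖ ^ 2) ^ (1 / 2 : ℝ))) := by
  obtain ⟨K, hK, hconv⟩ := exists_lintegral_normWeight_mul_sq_convolution_le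
    (volume : Measure (EuclideanSpace ℝ (Fin 3))) hs
    (by rw [finrank_euclideanSpace_fin]; push_cast; linarith)
  rw [finrank_euclideanSpace_fin, show 2 * (s₁ + s₂) - ((3 : ℕ) : ℝ) =
    2 * (s₁ + s₂ - 3 / 2) by push_cast; ring] at hconv
  refine ⟨K.toReal ^ (1 / 2 : ℝ) + 1, by positivity, fun F G hF hG hF₁ hF₂ hG₁ hG₂ ↦ ?_⟩
  have hbound := hconv (fun x ↦ ‖F x‖ₑ) (fun x ↦ ‖G x‖ₑ) hF.enorm hG.enorm
  simp only [lintegral_normWeight_mul_sq_enorm hF₁, lintegral_normWeight_mul_sq_enorm hF₂,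
    lintegral_normWeight_mul_sq_enorm hG₁, lintegral_normWeight_mul_sq_enorm hG₂] at hbound
  have hnn (s : ℝ) (u : EuclideanSpace ℝ (Fin 3) → ℂ) :
      0 ≤ ∫ ξ, ‖ξ‖ ^ (2 * s) * ‖u ξ‖ ^ 2 := integral_nonneg fun ξ ↦ by positivity
  have hF₁' := hnn s₁ F
  have hF₂' := hnn s₂ F
  have hG₁' := hnn s₁ G
  have hG₂' := hnn s₂ G
  set a := ∫ ξ, ‖ξ‖ ^ (2 * s₁) * ‖F ξ‖ ^ 2
  set b := ∫ ξ, ‖ξ‖ ^ (2 * s₂) * ‖G ξ‖ ^ 2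
  set c := ∫ ξ, ‖ξ‖ ^ (2 * s₂) * ‖F ξ‖ ^ 2
  set e := ∫ ξ, ‖ξ‖ ^ (2 * s₁) * ‖G ξ‖ ^ 2
  constructor
  · have hmeas : Measurable fun x ↦ ∫⁻ y, ‖F y‖ₑ * ‖G (x - y)‖ₑ :=
      Measurable.lintegral_prod_right' (f := fun q : EuclideanSpace ℝ (Fin 3) × _ ↦
        ‖F q.2‖ₑ * ‖G (q.1 - q.2)‖ₑ) (by fun_prop)
    have hw := measurable_normWeight (E := EuclideanSpace ℝ (Fin 3)) (2 * (s₁ + s₂ - 3 / 2))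
    have hfin := ae_lt_top (by fun_prop) (hbound.trans_lt
      (by simp [ENNReal.mul_lt_top_iff, hK.lt_top])).ne
    filter_upwards [hfin, ae_ne_zero_of_isAddHaarMeasure volume] with x hx hx0
    refine ⟨by fun_prop, ?_⟩
    simp only [HasFiniteIntegral, enorm_mul]
    by_contra hcon
    rw [not_lt_top_iff] at hcon
    simp [hcon, ENNReal.mul_top (normWeight_ne_zero _ hx0)] at hx
  · have hle : ∫⁻ ξ, ENNReal.ofReal
        (‖ξ‖ ^ (2 * (s₁ + s₂ - 3 / 2)) * ‖∫ η, F η * G (ξ - η)‖ ^ 2) ≤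
        K * (ENNReal.ofReal a * ENNReal.ofReal b + ENNReal.ofReal c * ENNReal.ofReal e) := by
      refine (lintegral_mono fun x ↦ ?_).trans hbound
      rw [ENNReal.ofReal_mul (by positivity), ENNReal.ofReal_pow (norm_nonneg _), ofReal_norm]
      change normWeight _ x * _ ≤ _
      gcongr
      refine (enorm_integral_le_lintegral_enorm _).trans_eq ?_
      simp only [enorm_mul]
    have hhalf : (0 : ℝ) ≤ 1 / 2 := by norm_num
    calc _ ≤ (K * (ENNReal.ofReal a * ENNReal.ofReal b +
          ENNReal.ofReal c * ENNReal.ofReal e)) ^ (1 / 2 : ℝ) := by gcongr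
      _ ≤ K ^ (1 / 2 : ℝ) * ((ENNReal.ofReal a * ENNReal.ofReal b) ^ (1 / 2 : ℝ) +
          (ENNReal.ofReal c * ENNReal.ofReal e) ^ (1 / 2 : ℝ)) := by
          rw [ENNReal.mul_rpow_of_nonneg _ _ hhalf]
          gcongr
          exact ENNReal.rpow_add_le_add_rpow _ _ hhalf (by norm_num)
      _ = ENNReal.ofReal (K.toReal ^ (1 / 2 : ℝ) * (a ^ (1 / 2 : ℝ) * b ^ (1 / 2 : ℝ) +
          c ^ (1 / 2 : ℝ) * e ^ (1 / 2 : ℝ))) := by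
          rw [ENNReal.ofReal_mul (by positivity), ENNReal.ofReal_add (by positivity)
            (by positivity), ENNReal.ofReal_mul (by positivity), ENNReal.ofReal_mul (by positivity)]
          simp only [ENNReal.mul_rpow_of_nonneg _ _ hhalf]
          rw [← ENNReal.ofReal_rpow_of_nonneg ENNReal.toReal_nonneg hhalf,
            ← ENNReal.ofReal_rpow_of_nonneg hF₁' hhalf, ← ENNReal.ofReal_rpow_of_nonneg hF₂' hhalf,
            ← ENNReal.ofReal_rpow_of_nonneg hG₁' hhalf, ← ENNReal.ofReal_rpow_of_nonneg hG₂' hhalf,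
            ENNReal.ofReal_toReal hK]
      _ ≤ _ := by
          apply ENNReal.ofReal_le_ofReal
          gcongr
          linarith
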